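/- Let k be a perfect field with algebraic closure K, and let f, g ∈ k[x] be monic irreducible polynomials with f(0) ≠ 0 ≠ g(0); let Λ ⊂ K and M ⊂ K be the sets of zeros of f and g respectively. Then there exist monic irreducible polynomials h_1, …, h_n ∈ k[x] with h_j(0) ≠ 0 for all j such that the k[x]-module k[x]/f ⊗ k[x]/g is isomorphic to ⊕_{j=1}^n k[x]/h_j, and moreover ∏_{j=1}^n h_j(x) = ∏_{(λ,μ) ∈ Λ×M} (x − λμ) in K[x]; that is, the zeros of the h_j in K, counted with repetitions, are exactly the products λμ with (λ, μ) ∈ Λ × M. -/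

import Mathlib

open Polynomial TensorProduct

/-- The `k`-linear operator on the `k[x]`-module `k[x]/(h)` given by the action of `x`,
i.e. multiplication by `x`. -/
noncomputable def mulXop (k : Type*) [Field k] (h : k[X]) :
    (k[X] ⧸ Ideal.span {h}) →ₗ[k] (k[X] ⧸ Ideal.span {h}) :=
  LinearMap.mulLeft k (Ideal.Quotient.mk (Ideal.span {h}) X)

/-- Two `k[x]`-modules, presented as vector spaces equipped with the `k`-linear operator
by which `x` acts, are isomorphic iff there is a `k`-linear equivalence intertwining the
two operators. -/
def OpIso {k V W : Type*} [Field k] [AddCommGroup V] [Module k V]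
    [AddCommGroup W] [Module k W] (f : V →ₗ[k] V) (g : W →ₗ[k] W) : Prop :=
  ∃ e : V ≃ₗ[k] W, ∀ v, e (f v) = g (e v)

/-- The direct sum of a family of operators, as an operator on the direct sum
(product) of the underlying spaces. -/
def piOp {k : Type*} [Field k] {ι : Type*} {V : ι → Type*} [∀ i, AddCommGroup (V i)]
    [∀ i, Module k (V i)] (f : ∀ i, V i →ₗ[k] V i) : (∀ i, V i) →ₗ[k] (∀ i, V i) :=
  LinearMap.pi fun i => (f i).comp (LinearMap.proj i)


theorem aux_enum {K : Type*} (s : Multiset K) (n : ℕ) (hs : Multiset.card s = n) :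
    ∃ l : Fin n → K, s = Finset.univ.val.map l := by
  have h1 : s.toList.length = n := by rw [Multiset.length_toList, hs]
  subst h1
  refine ⟨fun i => s.toList.get i, ?_⟩
  rw [Fin.univ_val_map, List.ofFn_get, Multiset.coe_toList]

theorem aux_charpoly_pi {k : Type*} [Field k] {n : ℕ} {V : Fin n → Type*}
    [∀ i, AddCommGroup (V i)] [∀ i, Module k (V i)] [∀ i, Module.Finite k (V i)]
    (f : ∀ i, V i →ₗ[k] V i) : (piOp f).charpoly = ∏ i, (f i).charpoly := by
  induction n with
  | zero =>
    rw [Finset.univ_eq_empty, Finset.prod_empty]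
    refine (LinearMap.charpoly_monic _).natDegree_eq_zero.1 ?_
    rw [LinearMap.charpoly_natDegree]
    exact Module.finrank_zero_of_subsingleton
  | succ n ih =>
    let e := (Fin.consLinearEquiv k V).symm
    have h : e.conj (piOp f) = (f 0).prodMap (piOp fun i : Fin n => f i.succ) := by
      refine LinearMap.ext fun v => ?_
      rw [LinearEquiv.conj_apply_apply]
      apply e.symm.injective
      rw [LinearEquiv.symm_apply_apply]
      funext i
      refine Fin.cases ?_ (fun i => ?_) i <;> rfl
    rw [← e.charpoly_conj, h, LinearMap.charpoly_prodMap, ih, Fin.prod_univ_succ]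

/-- Diagonalisation of the multiplication operator. -/
theorem aux_diag {k K : Type*} [Field k] [PerfectField k] [Field K] [Algebra k K]
    [IsAlgClosure k K] (f : k[X]) (hfm : f.Monic) (hf : Irreducible f)
    [Module.Finite k (k[X] ⧸ Ideal.span {f})] :
    ∃ (n : ℕ) (b : Module.Basis (Fin n) k (k[X] ⧸ Ideal.span {f})) (l : Fin n → K)
      (V : Matrix (Fin n) (Fin n) K), IsUnit V.det ∧
      V * (LinearMap.toMatrix b b (mulXop k f)).map (algebraMap k K) = Matrix.diagonal l * V ∧
      f.aroots K = Finset.univ.val.map l ∧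
      (mulXop k f).charpoly = f := by
  classical
  have := IsAlgClosure.isAlgClosed k (K := K)
  have hsep : f.Separable := PerfectField.separable_of_irreducible hf
  have hnd : (f.aroots K).Nodup := nodup_roots hsep.map
  have hcard : Multiset.card (f.aroots K) = f.natDegree := by
    rw [← natDegree_map (algebraMap k K) (p := f)]
    exact (IsAlgClosed.splits _).natDegree_eq_card_roots.symm
  let pb : PowerBasis k (AdjoinRoot f) := AdjoinRoot.powerBasis' hfm
  have hdim : pb.dim = f.natDegree := AdjoinRoot.powerBasis'_dim hfm
  obtain ⟨l, hl⟩ : ∃ l : Fin pb.dim → K, f.aroots K = Finset.univ.val.map l := by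
    exact aux_enum _ _ (hcard.trans hdim.symm)
  have hinj : Function.Injective l := by
    rw [hl] at hnd
    intro i j hij
    exact Multiset.inj_on_of_nodup_map hnd i (Finset.mem_univ_val i) j (Finset.mem_univ_val j) hij
  have hroot : ∀ i, f.eval₂ (algebraMap k K) (l i) = 0 := by
    intro i
    have : l i ∈ f.aroots K := by rw [hl]; exact Multiset.mem_map_of_mem _ (Finset.mem_univ_val i)
    exact (mem_aroots.1 this).2
  let φ : Fin pb.dim → (AdjoinRoot f →ₐ[k] K) := fun i =>
    AdjoinRoot.liftAlgHom f (Algebra.ofId k K) (l i) (hroot i)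
  have hφ : ∀ i, φ i (AdjoinRoot.root f) = l i := by
    intro i
    exact AdjoinRoot.liftAlgHom_root _ _ _ _
  have hgen : pb.gen = AdjoinRoot.root f := AdjoinRoot.powerBasis'_gen hfm
  have hmat : LinearMap.toMatrix pb.basis pb.basis (mulXop k f)
      = Algebra.leftMulMatrix pb.basis pb.gen := by
    rw [hgen]; rfl
  refine ⟨pb.dim, pb.basis, l, Matrix.vandermonde l, ?_, ?_, hl, ?_⟩
  · exact (Matrix.det_vandermonde_ne_zero_iff.2 hinj).isUnit
  · erw [hmat]
    ext i j
    rw [Matrix.diagonal_mul, Matrix.mul_apply]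
    have h1 : ∀ j, Matrix.vandermonde l i j = φ i (pb.basis j) := by
      intro j
      rw [Matrix.vandermonde_apply, pb.basis_eq_pow, map_pow, hgen, hφ]
    simp only [h1, Matrix.map_apply]
    rw [← hφ i, ← hgen, ← map_mul, ← pb.basis.sum_repr (pb.gen * pb.basis j), map_sum]
    refine Finset.sum_congr rfl fun a _ => ?_
    rw [map_smul, Algebra.leftMulMatrix_eq_repr_mul, Algebra.smul_def, mul_comm]
  · rw [← LinearMap.charpoly_toMatrix (mulXop k f) pb.basis]
    erw [hmat]
    rw [charpoly_leftMulMatrix, hgen, AdjoinRoot.minpoly_root hf.ne_zero, hfm.leadingCoeff]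
    simp

theorem aux_charpoly_tensor {k K : Type*} [Field k] [PerfectField k] [Field K] [Algebra k K]
    [IsAlgClosure k K] (f g : k[X]) (hfm : f.Monic) (hgm : g.Monic)
    (hf : Irreducible f) (hg : Irreducible g) [Module.Finite k (k[X] ⧸ Ideal.span {f})]
    [Module.Finite k (k[X] ⧸ Ideal.span {g})] :
    (TensorProduct.map (mulXop k f) (mulXop k g)).charpoly.map (algebraMap k K) =
        ((f.aroots K ×ˢ g.aroots K).map fun q : K × K => X - C (q.1 * q.2)).prod := by
  classical
  obtain ⟨n, b, l, V, hV, hVM, hl, -⟩ := aux_diag (K := K) f hfm hf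
  obtain ⟨m, c, r, W, hW, hWM, hr, -⟩ := aux_diag (K := K) g hgm hg
  rw [← LinearMap.charpoly_toMatrix _ (b.tensorProduct c), TensorProduct.toMatrix_map,
    ← Matrix.charpoly_map]
  set M := LinearMap.toMatrix b b (mulXop k f)
  set N := LinearMap.toMatrix c c (mulXop k g)
  have e1 : (Matrix.kroneckerMap (· * ·) M N).map (algebraMap k K)
      = Matrix.kroneckerMap (· * ·) (M.map (algebraMap k K)) (N.map (algebraMap k K)) := by
    ext; simp
  have e2 : Matrix.kroneckerMap (· * ·) V W * Matrix.kroneckerMap (· * ·) (M.map (algebraMap k K)) (N.map (algebraMap k K)) =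
     Matrix.diagonal (fun q : Fin n × Fin m => l q.1 * r q.2) * Matrix.kroneckerMap (· * ·) V W := by
    rw [← Matrix.mul_kronecker_mul, hVM, hWM, Matrix.mul_kronecker_mul,
      Matrix.diagonal_kronecker_diagonal]
  have hu : IsUnit (Matrix.kroneckerMap (· * ·) V W) := by
    rw [Matrix.isUnit_iff_isUnit_det, Matrix.det_kronecker]
    exact (hV.pow _).mul (hW.pow _)
  have hdet := (Matrix.isUnit_iff_isUnit_det _).1 hu
  obtain ⟨u, hu⟩ := hu
  rw [← hu] at hdet
  rw [← hu] at e2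
  erw [e1]
  rw [← Matrix.charpoly_units_conj u, e2, Matrix.mul_nonsing_inv_cancel_right _ _ hdet, Matrix.charpoly_diagonal, hl, hr]
  have : (Multiset.map l Finset.univ.val ×ˢ Multiset.map r Finset.univ.val)
     = Multiset.map (Prod.map l r) (Finset.univ : Finset (Fin n × Fin m)).val := by
    rw [← Finset.univ_product_univ, Finset.product_val]
    change Multiset.product _ _ = Multiset.map _ (Multiset.product _ _)
    simp only [Multiset.product, Multiset.bind_map, Multiset.map_bind, Multiset.map_map]
    rfl
  rw [this, Multiset.map_map]
  rfl

theorem aux_aeval (k : Type*) [Field k] (f : k[X]) : aeval (mulXop k f : Module.End k (k[X] ⧸ Ideal.span {f})) f = 0 := by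
  have h : (mulXop k f : Module.End k (k[X] ⧸ Ideal.span {f})) =
    Algebra.lmul k _ (Ideal.Quotient.mkₐ k (Ideal.span {f}) X) := rfl
  rw [h, aeval_algHom_apply, aeval_algHom_apply, aeval_X_left_apply]
  have : Ideal.Quotient.mkₐ k (Ideal.span {f}) f = 0 :=
    Ideal.Quotient.eq_zero_iff_mem.2 (Ideal.mem_span_singleton_self f)
  rw [this, map_zero]

theorem aux_ss {k V W : Type*} [Field k] [PerfectField k] [AddCommGroup V] [Module k V]
    [AddCommGroup W] [Module k W] [Module.Finite k V] [Module.Finite k W]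
    (A : Module.End k V) (B : Module.End k W) (f g : k[X])
    (hf : Irreducible f) (hg : Irreducible g) (hA : aeval A f = 0) (hB : aeval B g = 0) :
    Module.End.IsSemisimple (TensorProduct.map A B) := by
  have h : TensorProduct.map A B =
      Module.End.rTensorAlgHom k V W A * Module.End.lTensorAlgHom k W V B := by
    exact TensorProduct.ext' fun _ _ => rfl
  rw [h]
  refine Module.End.IsSemisimple.mul_of_commute ?_ ?_ ?_
  · exact TensorProduct.ext' fun _ _ => rfl
  · refine Module.End.isSemisimple_of_squarefree_aeval_eq_zero hf.squarefree ?_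
    rw [aeval_algHom_apply, hA, map_zero]
  · refine Module.End.isSemisimple_of_squarefree_aeval_eq_zero hg.squarefree ?_
    rw [aeval_algHom_apply, hB, map_zero]

theorem aux_decomp {k V : Type*} [Field k] [AddCommGroup V] [Module k V] [Module.Finite k V]
    (T : Module.End k V) (hT : T.IsSemisimple) :
    ∃ (n : ℕ) (h : Fin n → k[X]), (∀ j, (h j).Monic ∧ Irreducible (h j)) ∧
      OpIso T (piOp fun j => mulXop k (h j)) := by
  classical
  have : IsSemisimpleModule k[X] (Module.AEval' T) := hT
  obtain ⟨n, S, e, hs⟩ := IsSemisimpleModule.exists_linearEquiv_fin_dfinsupp k[X] (Module.AEval' T)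
  have key : ∀ i, ∃ h : k[X], h.Monic ∧ Irreducible h ∧
      Nonempty (S i ≃ₗ[k[X]] k[X] ⧸ Ideal.span {h}) := by
    intro i
    obtain ⟨I, hI, ⟨e'⟩⟩ := isSimpleModule_iff_quot_maximal.1 (hs i)
    have hne : I ≠ ⊥ := Ring.ne_bot_of_isMaximal_of_not_isField hI (Polynomial.not_isField k)
    obtain ⟨p, rfl⟩ := (IsPrincipalIdealRing.principal I).principal
    have hp : p ≠ 0 := by
      rintro rfl
      exact hne (by simp)
    have hpi : Irreducible p := ((Ideal.span_singleton_prime hp).1 hI.isPrime).irreducible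
    refine ⟨normalize p, monic_normalize hp, (normalize_associated p).symm.irreducible hpi, ⟨?_⟩⟩
    refine e'.trans (Submodule.quotEquivOfEq _ _ ?_)
    exact Ideal.span_singleton_eq_span_singleton.2 (normalize_associated p).symm
  choose h hm hi eq using key
  let E : Module.AEval' T ≃ₗ[k[X]] (∀ i, k[X] ⧸ Ideal.span {h i}) :=
    e.trans ((DFinsupp.linearEquivFunOnFintype).trans
      (LinearEquiv.piCongrRight fun i => (eq i).some))
  refine ⟨n, h, fun j => ⟨hm j, hi j⟩, (Module.AEval'.of T).trans (E.restrictScalars k), ?_⟩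
  intro v
  have h1 : Module.AEval'.of T (T v) = (X : k[X]) • Module.AEval'.of T v :=
    (Module.AEval'.X_smul_of T v).symm
  change E (Module.AEval'.of T (T v)) = piOp _ (E (Module.AEval'.of T v))
  rw [h1, map_smul]
  rfl

theorem stmt7 {k K : Type*} [Field k] [PerfectField k] [Field K] [Algebra k K]
    [IsAlgClosure k K] (f g : k[X]) (hfm : f.Monic) (hgm : g.Monic)
    (hf : Irreducible f) (hg : Irreducible g) (hf0 : f.eval 0 ≠ 0) (hg0 : g.eval 0 ≠ 0) :
    ∃ (n : ℕ) (h : Fin n → k[X]),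
      (∀ j, (h j).Monic ∧ Irreducible (h j) ∧ (h j).eval 0 ≠ 0) ∧
      OpIso (TensorProduct.map (mulXop k f) (mulXop k g)) (piOp fun j => mulXop k (h j)) ∧
      (∏ j, (h j).map (algebraMap k K)) =
        ((f.aroots K ×ˢ g.aroots K).map fun q : K × K => X - C (q.1 * q.2)).prod := by
  have fin : ∀ p : k[X], p.Monic → Module.Finite k (k[X] ⧸ Ideal.span {p}) :=
    fun p hp => (AdjoinRoot.powerBasis' hp).finite
  have := fin f hfm
  have := fin g hgm
  obtain ⟨n, h, hh, hiso⟩ := aux_decomp (TensorProduct.map (mulXop k f) (mulXop k g))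
    (aux_ss _ _ f g hf hg (aux_aeval k f) (aux_aeval k g))
  have hfin : ∀ j, Module.Finite k (k[X] ⧸ Ideal.span {h j}) := fun j => fin _ (hh j).1
  have hprod : (∏ j, (h j).map (algebraMap k K)) =
        ((f.aroots K ×ˢ g.aroots K).map fun q : K × K => X - C (q.1 * q.2)).prod := by
    rw [← aux_charpoly_tensor f g hfm hgm hf hg]
    obtain ⟨e, he⟩ := hiso
    have hc : e.conj (TensorProduct.map (mulXop k f) (mulXop k g))
        = piOp fun j => mulXop k (h j) := by
      refine LinearMap.ext fun v => ?_
      rw [LinearEquiv.conj_apply_apply, he, LinearEquiv.apply_symm_apply]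
    rw [← e.charpoly_conj, hc, aux_charpoly_pi, Polynomial.map_prod]
    refine Finset.prod_congr rfl fun j _ => ?_
    obtain ⟨_, _, _, _, _, _, _, hcp⟩ := aux_diag (K := K) (h j) (hh j).1 (hh j).2
    rw [hcp]
  refine ⟨n, h, fun j => ⟨(hh j).1, (hh j).2, fun h0 => ?_⟩, hiso, hprod⟩
  have hz : (∏ j, (h j).map (algebraMap k K)).eval 0 = 0 := by
    rw [eval_prod]
    refine Finset.prod_eq_zero (Finset.mem_univ j) ?_
    rw [← map_zero (algebraMap k K), eval_map_apply, h0, map_zero]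
  rw [hprod, eval_multiset_prod, Multiset.prod_eq_zero_iff, Multiset.map_map] at hz
  obtain ⟨q, hq, hq0⟩ := Multiset.mem_map.1 hz
  obtain ⟨h1, h2⟩ := Multiset.mem_product.1 hq
  have key : ∀ p : k[X], p.eval 0 ≠ 0 → ∀ x ∈ p.aroots K, x ≠ 0 := by
    rintro p hp x hx rfl
    have := (mem_aroots.1 hx).2
    rw [← map_zero (algebraMap k K), aeval_algebraMap_apply, map_zero] at this
    exact hp (by simpa using this)
  have : q.1 * q.2 = 0 := by simpa using hq0
  exact mul_ne_zero (key f hf0 _ h1) (key g hg0 _ h2) this
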